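/- Let X be a proper metric space with a consistent, A-convex, constant-speed bicombing γ with γ_{x,x}(t) = x for all x, t, where A is monotonically increasing in its second and third arguments and, in its first argument, monotonically increasing on [0,1/3] and monotonically decreasing on [2/3,1], and suppose there is a monotonically increasing continuous f : [0,∞) → [0,∞) with f(0) = 0 and |l(γ_{x,y}) − l(γ_{x',y'})| ≤ f(d(x,x') + d(y,y')). Let β, L > 0 be given. Then for every δ > 0 there exist T, r > 0 such that for all x₁, x₂ ∈ X with d(x₁,x₂) ≤ β and all x ∈ P_{r+L}(x₁), there exists τ ∈ [−f(β), f(β)] with D(Φ_T(c_{x₁, c_{x₁,x}(r)}), Φ_{T+τ}(c_{x₂, c_{x₂,x}(r)})) ≤ δ. -/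

import Mathlib

open MeasureTheory Set

namespace FJ

/-- A constant-speed bicombing on a metric space `X`: a continuous map
`γ : X × X × [0,1] → X` such that each `γ_{x,y} := γ(x,y,·)` is a rectifiable path from `x`
to `y` of constant speed equal to its length `len x y`. -/
structure ConstSpeedBicombing (X : Type*) [MetricSpace X] where
  toFun : X → X → ℝ → X
  len : X → X → ℝ
  len_nonneg : ∀ x y, 0 ≤ len x y
  continuousOn : ContinuousOn (fun p : X × X × ℝ => toFun p.1 p.2.1 p.2.2)
      (Set.univ ×ˢ Set.univ ×ˢ Set.Icc (0:ℝ) 1)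
  source : ∀ x y, toFun x y 0 = x
  target : ∀ x y, toFun x y 1 = y
  speed : ∀ (x y : X) (s t : ℝ), 0 ≤ s → s ≤ t → t ≤ 1 →
      eVariationOn (toFun x y) (Set.Icc s t) = ENNReal.ofReal (len x y * (t - s))

/-- The trail `c_{x,y} : ℝ → X` associated to a bicombing: constant `x` on `(-∞,0]`,
the path `γ_{x,y}` parametrised by arclength on `[0, len x y]`, constant `y` on
`[len x y, ∞)`. -/
noncomputable def trail {X : Type*} [MetricSpace X] (B : ConstSpeedBicombing X)
    (x y : X) : ℝ → X :=
  fun t => if t ≤ 0 then x else if t < B.len x y then B.toFun x y (t / B.len x y) else y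

/-- The shift `Φ_τ(f) = f(· + τ)`. -/
def timeShift {X : Type*} (τ : ℝ) (f : ℝ → X) : ℝ → X := fun t => f (t + τ)

/-- The metric `D` on `Lip₁(X)`: `D(f,g) = ∫_ℝ d(f t, g t) / (2 e^{|t|}) dt`. -/
noncomputable def lipDist {X : Type*} [MetricSpace X] (f g : ℝ → X) : ℝ :=
  ∫ t : ℝ, dist (f t) (g t) / (2 * Real.exp |t|)

/-- `A(X,γ) = {Φ_τ c_{x,y} | τ ∈ ℝ, x, y ∈ X}`, as a subset of `C(ℝ, X)` (whose
compact-open topology induces on `Lip₁(X)` the topology of the metric `D`). -/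
def ASet {X : Type*} [MetricSpace X] (B : ConstSpeedBicombing X) : Set C(ℝ, X) :=
  {w | ∃ (x y : X) (τ : ℝ), ∀ s, w s = trail B x y (s + τ)}

/-- The flow space `FS(X,γ)`, the closure of `A(X,γ)`. -/
def FSSet {X : Type*} [MetricSpace X] (B : ConstSpeedBicombing X) : Set C(ℝ, X) :=
  closure (ASet B)

/-- The restriction `res_{[a,b]}(w)`: equal to `w a` on `(-∞,a]`, to `w` on `[a,b]`,
and to `w b` on `[b,∞)`. -/
noncomputable def trailRes {X : Type*} (a b : ℝ) (w : ℝ → X) : ℝ → X :=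
  fun t => if t ≤ a then w a else if t ≤ b then w t else w b

/-- `A(X,γ,[a,b]) = A(X,γ) ∩ Lip₁(X,[a,b])`: the elements of `A(X,γ)` which are constant
on `(-∞,a]` and on `[b,∞)`. -/
def AIntSet {X : Type*} [MetricSpace X] (B : ConstSpeedBicombing X) (a b : ℝ) :
    Set C(ℝ, X) :=
  {w | w ∈ ASet B ∧ (∀ s, s ≤ a → w s = w a) ∧ (∀ s, b ≤ s → w s = w b)}

/-- A bicombing is consistent if the chosen paths behave well under restriction. -/
def BicombingConsistent {X : Type*} [MetricSpace X] (B : ConstSpeedBicombing X) : Prop :=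
  ∀ (x y : X) (s s' t : ℝ), 0 ≤ s → s < s' → s' ≤ 1 → s ≤ t → t ≤ s' →
    B.toFun x y t = B.toFun (B.toFun x y s) (B.toFun x y s') ((t - s) / (s' - s))

/-- A bicombing is `A`-convex if `d(γ_{x,y}(t), γ_{x',y'}(t)) ≤ A(t, d(x,x'), d(y,y'))`. -/
def BicombingAConvex {X : Type*} [MetricSpace X] (B : ConstSpeedBicombing X)
    (A : ℝ → ℝ → ℝ → ℝ) : Prop :=
  ∀ (x x' y y' : X) (t : ℝ), 0 ≤ t → t ≤ 1 →
    dist (B.toFun x y t) (B.toFun x' y' t) ≤ A t (dist x x') (dist y y')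

/-- The conditions on the comparison function `A` of an `A`-convex bicombing:
`A : [0,1] × [0,∞) × [0,∞) → [0,∞)` is continuous with `A(1,s,0) = A(0,0,s) = 0`. -/
def ConvexityFun (A : ℝ → ℝ → ℝ → ℝ) : Prop :=
  ContinuousOn (fun p : ℝ × ℝ × ℝ => A p.1 p.2.1 p.2.2)
      (Set.Icc (0:ℝ) 1 ×ˢ Set.Ici (0:ℝ) ×ˢ Set.Ici (0:ℝ)) ∧
  (∀ t s s', 0 ≤ t → t ≤ 1 → 0 ≤ s → 0 ≤ s' → 0 ≤ A t s s') ∧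
  (∀ s, 0 ≤ s → A 1 s 0 = 0) ∧ (∀ s, 0 ≤ s → A 0 0 s = 0)

/-- The monotonicity conditions on `A`: monotonically increasing in the second and third
arguments and, in the first argument, monotonically increasing on `[0,1/3]` and
monotonically decreasing on `[2/3,1]`. -/
def MonotoneConvexityFun (A : ℝ → ℝ → ℝ → ℝ) : Prop :=
  (∀ t s₁ s₂ s', 0 ≤ t → t ≤ 1 → 0 ≤ s₁ → s₁ ≤ s₂ → 0 ≤ s' → A t s₁ s' ≤ A t s₂ s') ∧
  (∀ t s s₁ s₂, 0 ≤ t → t ≤ 1 → 0 ≤ s → 0 ≤ s₁ → s₁ ≤ s₂ → A t s s₁ ≤ A t s s₂) ∧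
  (∀ t₁ t₂ s s', 0 ≤ t₁ → t₁ ≤ t₂ → t₂ ≤ 1/3 → 0 ≤ s → 0 ≤ s' → A t₁ s s' ≤ A t₂ s s') ∧
  (∀ t₁ t₂ s s', 2/3 ≤ t₁ → t₁ ≤ t₂ → t₂ ≤ 1 → 0 ≤ s → 0 ≤ s' → A t₂ s s' ≤ A t₁ s s')

section Trail

variable {X : Type*} [MetricSpace X]

lemma ConstSpeedBicombing.dist_toFun_le (B : ConstSpeedBicombing X) (x y : X) {s t : ℝ}
    (hs : 0 ≤ s) (hst : s ≤ t) (ht : t ≤ 1) :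
    dist (B.toFun x y s) (B.toFun x y t) ≤ B.len x y * (t - s) := by
  have h := eVariationOn.edist_le (B.toFun x y) (s := Icc s t)
    (left_mem_Icc.2 hst) (right_mem_Icc.2 hst)
  rw [B.speed x y s t hs hst ht, edist_dist] at h
  exact (ENNReal.ofReal_le_ofReal_iff
    (mul_nonneg (B.len_nonneg x y) (sub_nonneg.2 hst))).1 h

lemma ConstSpeedBicombing.eq_of_len_eq_zero (B : ConstSpeedBicombing X) {x y : X}
    (h : B.len x y = 0) : x = y := by
  have := B.dist_toFun_le x y le_rfl zero_le_one le_rfl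
  rw [B.source, B.target, h, zero_mul] at this
  exact dist_le_zero.1 this

lemma ConstSpeedBicombing.len_toFun (B : ConstSpeedBicombing X) (hcons : BicombingConsistent B)
    (x y : X) {s : ℝ} (hs : 0 < s) (hs1 : s ≤ 1) :
    B.len x (B.toFun x y s) = B.len x y * s := by
  have himage : (fun t : ℝ => t / s) '' Icc 0 s = Icc 0 1 := by
    simp only [div_eq_mul_inv]
    rw [Set.image_mul_right_Icc hs.le (inv_nonneg.2 hs.le), zero_mul, mul_inv_cancel₀ hs.ne']
  have hvar : eVariationOn (B.toFun x y) (Icc 0 s) =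
      eVariationOn (B.toFun x (B.toFun x y s)) (Icc 0 1) := by
    rw [← himage, ← eVariationOn.comp_eq_of_monotoneOn]
    · refine eVariationOn.congr fun t ht => ?_
      have := hcons x y 0 s t le_rfl hs hs1 ht.1 ht.2
      simpa [B.source] using this
    · intro a _ b _ hab
      exact div_le_div_of_nonneg_right hab hs.le
  rw [B.speed x y 0 s le_rfl hs.le hs1, B.speed _ _ 0 1 le_rfl zero_le_one le_rfl] at hvar
  have := (ENNReal.ofReal_eq_ofReal_iff (by have := B.len_nonneg x y; simpa using by positivity)
    (by simpa using B.len_nonneg _ _)).1 hvar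
  linarith

lemma trail_of_le (B : ConstSpeedBicombing X) {x y : X} {t : ℝ} (h : B.len x y ≤ t) :
    trail B x y t = y := by
  unfold trail
  split_ifs with h0 h1
  · exact B.eq_of_len_eq_zero (le_antisymm (h.trans h0) (B.len_nonneg x y))
  · exact absurd h (not_le.2 h1)
  · rfl

lemma trail_of_mem (B : ConstSpeedBicombing X) {x y : X} {t : ℝ} (h0 : 0 ≤ t)
    (h : t ≤ B.len x y) (hpos : 0 < B.len x y) :
    trail B x y t = B.toFun x y (t / B.len x y) := by
  rcases h.eq_or_lt with h | h
  · rw [trail_of_le B h.ge, h, div_self hpos.ne', B.target]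
  · unfold trail
    split_ifs with h1
    · rw [le_antisymm h1 h0, zero_div, B.source]
    · rfl

lemma trail_eq_toFun_clamp (B : ConstSpeedBicombing X) {x y : X} (hpos : 0 < B.len x y) (t : ℝ) :
    trail B x y t = B.toFun x y (max 0 (min t (B.len x y)) / B.len x y) := by
  rcases le_total t 0 with h0 | h0
  · rw [max_eq_left ((min_le_left _ _).trans h0), zero_div, B.source]
    simp [trail, h0]
  rcases le_total t (B.len x y) with h | h
  · rw [min_eq_left h, max_eq_right h0, trail_of_mem B h0 h hpos]
  · rw [min_eq_right h, max_eq_right hpos.le, div_self hpos.ne', B.target, trail_of_le B h]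

lemma dist_trail_le (B : ConstSpeedBicombing X) (x y : X) (s t : ℝ) :
    dist (trail B x y s) (trail B x y t) ≤ |s - t| := by
  wlog hst : s ≤ t generalizing s t
  · rw [dist_comm, abs_sub_comm]
    exact this t s (le_of_not_ge hst)
  rcases (B.len_nonneg x y).eq_or_lt with h | hpos
  · obtain rfl := B.eq_of_len_eq_zero h.symm
    have hconst : ∀ t, trail B x x t = x := fun t => by
      rcases le_total t 0 with ht | ht
      · simp [trail, ht]
      · exact trail_of_le B (h.symm.trans_le ht)
    rw [hconst, hconst, dist_self]
    exact abs_nonneg _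
  have hle : max 0 (min s (B.len x y)) ≤ max 0 (min t (B.len x y)) := by gcongr
  rw [trail_eq_toFun_clamp B hpos, trail_eq_toFun_clamp B hpos]
  refine (B.dist_toFun_le x y (by positivity) (by gcongr) ?_).trans ?_
  · rw [div_le_one hpos]
    exact max_le hpos.le (min_le_right _ _)
  · rw [← sub_div, mul_div_cancel₀ _ hpos.ne', abs_sub_comm, abs_of_nonneg (sub_nonneg.2 hst)]
    rcases max_cases 0 (min s (B.len x y)) with h1 | h1 <;>
    rcases max_cases 0 (min t (B.len x y)) with h2 | h2 <;>
    rcases min_cases s (B.len x y) with h3 | h3 <;>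
    rcases min_cases t (B.len x y) with h4 | h4 <;> linarith

lemma trail_trail (B : ConstSpeedBicombing X) (hcons : BicombingConsistent B)
    (x y : X) {r : ℝ} (hr : 0 < r) (t : ℝ) :
    trail B x (trail B x y r) t = trail B x y (min t r) := by
  rcases le_or_gt (B.len x y) r with h | h
  · rw [trail_of_le B h]
    rcases le_total t r with ht | ht
    · rw [min_eq_left ht]
    · rw [min_eq_right ht, trail_of_le B h, trail_of_le B (h.trans ht)]
  have hpos := hr.trans h
  have hz : trail B x y r = B.toFun x y (r / B.len x y) := trail_of_mem B hr.le h.le hpos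
  have hlen : B.len x (trail B x y r) = r := by
    rw [hz, B.len_toFun hcons x y (by positivity) ((div_le_one hpos).2 h.le),
      mul_div_cancel₀ _ hpos.ne']
  rcases le_total r t with ht | ht
  · rw [min_eq_right ht, trail_of_le B (hlen.trans_le ht)]
  rw [min_eq_left ht]
  rcases le_total t 0 with h0 | h0
  · simp [trail, h0]
  rw [trail_of_mem B h0 (ht.trans hlen.ge) (hr.trans_eq hlen.symm), hlen,
    trail_of_mem B h0 (ht.trans h.le) hpos, hz]
  have := hcons x y 0 (r / B.len x y) (t / B.len x y) le_rfl (by positivity)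
    ((div_le_one hpos).2 h.le) (by positivity) (by gcongr)
  rw [this, B.source, sub_zero, sub_zero, div_div_div_cancel_right₀ hpos.ne']

lemma dist_trail_trail_le_of_abs_le (B : ConstSpeedBicombing X) {x₁ x₂ x : X}
    {F R S M a t : ℝ} (hF : |B.len x₁ x - B.len x₂ x| ≤ F) (hFS : F < S)
    (hlen : B.len x₁ x ≤ S + M) (ht : |t| ≤ R) (ha : 0 ≤ a)
    (hconv : ∀ u, S / (S + M) ≤ u → u ≤ 1 → dist (B.toFun x₁ x u) (B.toFun x₂ x u) ≤ a) :
    dist (trail B x₁ x (S + R + t))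
      (trail B x₂ x (S + R + min (S + R) (B.len x₁ x) / B.len x₁ x *
        (B.len x₂ x - B.len x₁ x) + t)) ≤ a + F * (2 * R) / S := by
  have hF0 : 0 ≤ F := (abs_nonneg _).trans hF
  have hR : 0 ≤ R := (abs_nonneg _).trans ht
  have hS : 0 < S := hF0.trans_lt hFS
  obtain ⟨ht1, ht2⟩ := abs_le.1 ht
  obtain ⟨hF1, hF2⟩ := abs_le.1 hF
  have hbound : 0 ≤ a + F * (2 * R) / S := by positivity
  set l₁ := B.len x₁ x with hl₁
  set l₂ := B.len x₂ x with hl₂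
  rcases lt_or_ge l₁ S with h | h
  · rw [trail_of_le B (by linarith), trail_of_le B]
    · rwa [dist_self]
    rw [← hl₂, min_eq_right (by linarith)]
    rcases (B.len_nonneg x₁ x).eq_or_lt with h0 | h0
    · rw [← hl₁] at h0
      rw [← h0] at hF1 ⊢
      rw [div_zero, zero_mul]
      linarith
    · rw [div_self h0.ne', one_mul]
      linarith
  have hpos : 0 < l₁ := hS.trans_le h
  have hpos₂ : 0 < l₂ := by linarith
  set u := (S + R + t) / l₁ with hu
  have hu0 : 0 ≤ u := div_nonneg (by linarith) hpos.le
  have hmid : dist (trail B x₁ x (S + R + t)) (trail B x₂ x (u * l₂)) ≤ a := by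
    rcases le_total (S + R + t) l₁ with h1 | h1
    · have hu1 : u ≤ 1 := (div_le_one hpos).2 h1
      rw [trail_of_mem B (by linarith) h1 hpos,
        trail_of_mem B (by positivity) (mul_le_of_le_one_left hpos₂.le hu1) hpos₂,
        mul_div_cancel_right₀ _ hpos₂.ne']
      refine hconv u ?_ hu1
      rw [hu]
      gcongr <;> linarith
    · rw [trail_of_le B h1, trail_of_le B (le_mul_of_one_le_left hpos₂.le ((one_le_div hpos).2 h1)),
        dist_self]
      exact ha
  refine (dist_triangle _ _ _).trans (add_le_add hmid ?_)
  refine (dist_trail_le B _ _ _ _).trans ?_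
  have heq : u * l₂ - (S + R + min (S + R) l₁ / l₁ * (l₂ - l₁) + t) =
      (l₁ - l₂) * (min (S + R) l₁ - (S + R) - t) / l₁ := by
    rw [hu]
    field_simp
    ring
  rw [heq, abs_div, abs_mul, abs_of_pos hpos]
  have hmin : |min (S + R) l₁ - (S + R) - t| ≤ 2 * R := by
    rw [abs_le]
    rcases min_cases (S + R) l₁ with h1 | h1 <;> constructor <;> linarith
  gcongr

end Trail

lemma one_add_sq_sq_le_exp_abs (t : ℝ) : (1 + t ^ 2) ^ 2 ≤ 30 * Real.exp |t| := by
  have h0 : 1 ≤ Real.exp |t| := Real.one_le_exp (abs_nonneg t)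
  have h2 := Real.pow_div_factorial_le_exp |t| (abs_nonneg t) 2
  have h4 := Real.pow_div_factorial_le_exp |t| (abs_nonneg t) 4
  have e2 : |t| ^ 2 = t ^ 2 := sq_abs t
  have e4 : |t| ^ 4 = t ^ 4 := by rw [show 4 = 2 * 2 from rfl, pow_mul, e2, ← pow_mul]
  norm_num [Nat.factorial, e2, e4] at h2 h4
  nlinarith

lemma lipDist_le_of_dist_le {X : Type*} [MetricSpace X] {g h : ℝ → X} {K : ℝ}
    (hgh : ∀ t, dist (g t) (h t) ≤ K * (1 + t ^ 2)) : lipDist g h ≤ K * 15 * Real.pi := by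
  have hint : Integrable fun t : ℝ => K * 15 * (1 + t ^ 2)⁻¹ :=
    integrable_inv_one_add_sq.const_mul _
  have hK : 0 ≤ K := by simpa using dist_nonneg.trans (hgh 0)
  calc lipDist g h ≤ ∫ t : ℝ, K * 15 * (1 + t ^ 2)⁻¹ := by
        refine integral_mono_of_nonneg (.of_forall fun t => ?_) hint (.of_forall fun t => ?_)
        · dsimp only [Pi.zero_apply]
          positivity
        · dsimp only
          have hp : 0 < 1 + t ^ 2 := by positivity
          rw [← div_eq_mul_inv, div_le_div_iff₀ (by positivity) hp]
          calc dist (g t) (h t) * (1 + t ^ 2) ≤ K * (1 + t ^ 2) * (1 + t ^ 2) := by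
                gcongr
                exact hgh t
            _ = K * (1 + t ^ 2) ^ 2 := by ring
            _ ≤ K * (30 * Real.exp |t|) := by
                gcongr
                exact one_add_sq_sq_le_exp_abs t
            _ = K * 15 * (2 * Real.exp |t|) := by ring
    _ = K * 15 * Real.pi := by rw [integral_const_mul, integral_univ_inv_one_add_sq]

lemma ConvexityFun.exists_forall_lt {A : ℝ → ℝ → ℝ → ℝ} (hA : ConvexityFun A) {β ε : ℝ}
    (hβ : 0 ≤ β) (hε : 0 < ε) :
    ∃ η > 0, ∀ u, 0 ≤ u → u ≤ 1 → 1 - η < u → A u β 0 < ε := by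
  have hc : ContinuousOn (fun u : ℝ => A u β 0) (Icc 0 1) :=
    hA.1.comp (f := fun u : ℝ => (u, β, (0 : ℝ))) (by fun_prop)
      fun u hu => ⟨hu, hβ, self_mem_Ici⟩
  obtain ⟨η, hη, h⟩ := Metric.continuousWithinAt_iff.1
    (hc 1 (right_mem_Icc.2 zero_le_one)) ε hε
  refine ⟨η, hη, fun u h0 h1 hu => ?_⟩
  have := h ⟨h0, h1⟩ (by rw [Real.dist_eq, abs_lt]; constructor <;> linarith)
  rw [hA.2.2.1 β hβ, Real.dist_eq, sub_zero] at this
  exact (le_abs_self _).trans_lt this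

/-- Proposition 3.5: with the standing assumptions (proper `X`; consistent, `A`-convex
constant-speed bicombing with `γ_{x,x}(t) = x`, `A` monotone as in the remark, monotone
continuous length control function `f`): for all `β, L > 0` and every `δ > 0` there are
`T, r > 0` such that for all `x₁, x₂` with `d(x₁,x₂) ≤ β` and all `x ∈ P_{r+L}(x₁)` there
is `τ ∈ [−f(β), f(β)]` with
`D(Φ_T(c_{x₁,c_{x₁,x}(r)}), Φ_{T+τ}(c_{x₂,c_{x₂,x}(r)})) ≤ δ`. -/
theorem exists_flow_time_moving_close {X : Type*} [MetricSpace X] [ProperSpace X]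
    (B : ConstSpeedBicombing X) (hcons : BicombingConsistent B)
    (hdiag : ∀ (x : X) (t : ℝ), 0 ≤ t → t ≤ 1 → B.toFun x x t = x)
    {A : ℝ → ℝ → ℝ → ℝ} (hA : ConvexityFun A) (hAmon : MonotoneConvexityFun A)
    (hconv : BicombingAConvex B A)
    (f : ℝ → ℝ) (hfc : ContinuousOn f (Set.Ici 0)) (hf0 : f 0 = 0)
    (hfnn : ∀ s, 0 ≤ s → 0 ≤ f s)
    (hfmono : ∀ s t : ℝ, 0 ≤ s → s ≤ t → f s ≤ f t)
    (hlen : ∀ x x' y y' : X, |B.len x y - B.len x' y'| ≤ f (dist x x' + dist y y'))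
    (β L : ℝ) (hβ : 0 < β) (hL : 0 < L) :
    ∀ δ > (0:ℝ), ∃ T > (0:ℝ), ∃ r > (0:ℝ), ∀ x₁ x₂ : X, dist x₁ x₂ ≤ β →
      ∀ x : X, B.len x₁ x ≤ r + L →
        ∃ τ : ℝ, -(f β) ≤ τ ∧ τ ≤ f β ∧
          lipDist (timeShift T (trail B x₁ (trail B x₁ x r)))
            (timeShift (T + τ) (trail B x₂ (trail B x₂ x r))) ≤ δ := by
  intro δ hδ
  obtain ⟨η, hη, hAη⟩ := hA.exists_forall_lt hβ.le (show 0 < δ / 200 by positivity)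
  have hF : 0 ≤ f β := hfnn β hβ.le
  set R := 200 / δ with hRdef
  have hR : 0 < R := by positivity
  set M := 2 * R + f β + L with hMdef
  have hM : 0 < M := by positivity
  set S := M / η + f β * (2 * R) / (δ / 200) + f β + 1 with hSdef
  have hS1 : M / η < S := by
    have : 0 ≤ f β * (2 * R) / (δ / 200) := by positivity
    linarith
  have hS2 : f β * (2 * R) / (δ / 200) < S := by
    have : 0 < M / η := by positivity
    linarith
  have hS3 : f β < S := by
    have : 0 < M / η := by positivity
    have : 0 ≤ f β * (2 * R) / (δ / 200) := by positivity
    linarith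
  have hS : 0 < S := hF.trans_lt hS3
  have hratio : 1 - η < S / (S + M) := by
    rw [div_lt_iff₀ hη] at hS1
    rw [lt_div_iff₀ (by positivity)]
    nlinarith [mul_pos hη hM]
  have herr : f β * (2 * R) / S ≤ δ / 200 := by
    rw [div_lt_iff₀ (by positivity)] at hS2
    rw [div_le_iff₀ hS]
    linarith
  refine ⟨S + R, by positivity, S + R + R + f β, by positivity, fun x₁ x₂ hx x hxr => ?_⟩
  have hl : |B.len x₁ x - B.len x₂ x| ≤ f β := by
    refine (hlen x₁ x₂ x x).trans (hfmono _ _ (by positivity) ?_)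
    rwa [dist_self, add_zero]
  set τ := min (S + R) (B.len x₁ x) / B.len x₁ x * (B.len x₂ x - B.len x₁ x) with hτdef
  have hτ : |τ| ≤ f β := by
    have h0 := B.len_nonneg x₁ x
    have h1 : 0 ≤ min (S + R) (B.len x₁ x) / B.len x₁ x := by positivity
    have h2 : min (S + R) (B.len x₁ x) / B.len x₁ x ≤ 1 := div_le_one_of_le₀ (min_le_right _ _) h0
    rw [hτdef, abs_mul, abs_of_nonneg h1, abs_sub_comm]
    exact (mul_le_of_le_one_left (abs_nonneg _) h2).trans hl
  obtain ⟨hτ1, hτ2⟩ := abs_le.1 hτ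
  refine ⟨τ, hτ1, hτ2, ?_⟩
  set r := S + R + R + f β with hrdef
  have hr : 0 < r := by positivity
  set g := timeShift (S + R) (trail B x₁ (trail B x₁ x r)) with hg
  set h := timeShift (S + R + τ) (trail B x₂ (trail B x₂ x r)) with hh
  have hnear : ∀ t, |t| ≤ R → dist (g t) (h t) ≤ δ / 100 := by
    intro t ht
    obtain ⟨ht1, ht2⟩ := abs_le.1 ht
    have key := dist_trail_trail_le_of_abs_le B (M := M) (a := δ / 200) hl hS3 (by linarith) ht
      (by positivity) (fun u hu hu1 => by
        have hu0 : 0 ≤ u := le_trans (by positivity) hu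
        refine (hconv x₁ x₂ x x u hu0 hu1).trans ?_
        rw [dist_self]
        exact (hAmon.1 u _ _ 0 hu0 hu1 dist_nonneg hx le_rfl).trans
          (hAη u hu0 hu1 (hratio.trans_le hu)).le)
    rw [hg, hh, timeShift, timeShift, trail_trail B hcons _ _ hr, trail_trail B hcons _ _ hr,
      min_eq_left (by linarith), min_eq_left (by linarith), add_comm t, add_comm t]
    linarith
  have hfar : ∀ t, dist (g t) (h t) ≤ δ / 100 + 2 * |t| := by
    intro t
    have h1 : dist (g t) (g 0) ≤ |t| :=
      (dist_trail_le B _ _ _ _).trans_eq (by congr 1; ring)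
    have h2 : dist (h 0) (h t) ≤ |t| :=
      (dist_trail_le B _ _ _ _).trans_eq (by rw [← abs_neg t]; congr 1; ring)
    have h3 := hnear 0 (by simpa using hR.le)
    have := dist_triangle4 (g t) (g 0) (h 0) (h t)
    linarith
  have hquad : ∀ t, dist (g t) (h t) ≤ δ / 50 * (1 + t ^ 2) := by
    intro t
    rcases le_total |t| R with ht | ht
    · have := hnear t ht
      nlinarith [mul_nonneg hδ.le (sq_nonneg t)]
    · have h1 := hfar t
      have h2 : 200 ≤ |t| * δ := by rwa [hRdef, div_le_iff₀ hδ] at ht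
      have h3 : 200 * |t| ≤ δ * t ^ 2 := by
        rw [← sq_abs]
        nlinarith [abs_nonneg t]
      nlinarith
  refine (lipDist_le_of_dist_le hquad).trans ?_
  nlinarith [Real.pi_lt_d2]
end FJ
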